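/- Fix an integer n ≥ 1. For every Ŷ ∈ M^<_n there exists Ẑ ∈ M^<_n such that for every linear ordering < on the vertex set of Ẑ with respect to which every λ^Ẑ-color class is <-convex, there is a copy Ỹ of Ŷ in Ẑ such that on every λ^Ỹ-color class, the orderings < and <^Ỹ coincide or are opposite. -/

import Mathlib

/-- `f` is an embedding of ordered graphs (vertex sets `Fin a`, `Fin c` with their
natural linear orders): strictly increasing, preserving and reflecting adjacency. -/
def OrdEmb {a c : ℕ} (X : SimpleGraph (Fin a)) (Z : SimpleGraph (Fin c))
    (f : Fin a → Fin c) : Prop :=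
  StrictMono f ∧ ∀ i j, Z.Adj (f i) (f j) ↔ X.Adj i j

/-- `lam` is a proper coloring of `X` with colors in `Fin n`. -/
def ProperCol {a n : ℕ} (X : SimpleGraph (Fin a)) (lam : Fin a → Fin n) : Prop :=
  ∀ i j, X.Adj i j → lam i ≠ lam j

/-- `f` is an embedding of ordered `[n]`-colored graphs: an ordered-graph embedding
that also preserves the vertex colorings. -/
def ColOrdEmb {n a c : ℕ} (X : SimpleGraph (Fin a)) (lamX : Fin a → Fin n)
    (Z : SimpleGraph (Fin c)) (lamZ : Fin c → Fin n) (f : Fin a → Fin c) : Prop :=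
  OrdEmb X Z f ∧ ∀ i, lamZ (f i) = lamX i

/-- `S` is the vertex set of an induced copy of the (unordered) graph `X` in `Z`. -/
def IsCopy {a c : ℕ} (X : SimpleGraph (Fin a)) (Z : SimpleGraph (Fin c))
    (S : Finset (Fin c)) : Prop :=
  ∃ f : Fin a → Fin c, Function.Injective f ∧
    (∀ i j, Z.Adj (f i) (f j) ↔ X.Adj i j) ∧ Finset.image f Finset.univ = S

/-- Erdős–Szekeres: a large finite subset of a linear order contains either a large set on which
the transitive relation `r` holds along the order, or a large set on which it never does. -/
theorem exists_subset_rel_or_not_rel {α : Type*} [LinearOrder α] (r : α → α → Prop)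
    (hr : ∀ x y z, r x y → r y z → r x z) (l : ℕ) (k : ℕ) :
    ∀ s : Finset α, k * l < s.card →
      (∃ t ⊆ s, t.card = k + 1 ∧ ∀ x ∈ t, ∀ y ∈ t, x < y → r x y) ∨
      (∃ t ⊆ s, t.card = l + 1 ∧ ∀ x ∈ t, ∀ y ∈ t, x < y → ¬ r x y) := by
  classical
  induction k with
  | zero =>
    intro s hs
    obtain ⟨x, hx⟩ := Finset.card_pos.mp (by omega : 0 < s.card)
    refine Or.inl ⟨{x}, by simpa using hx, by simp, ?_⟩
    intro y hy z hz hyz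
    rw [Finset.mem_singleton] at hy hz
    exact absurd hyz (by rw [hy, hz]; exact lt_irrefl x)
  | succ k ih =>
    intro s hs
    set m := s.filter fun x => ∀ y ∈ s, y < x → ¬ r y x with hm
    have hms : m ⊆ s := Finset.filter_subset _ _
    by_cases hl : l + 1 ≤ m.card
    · obtain ⟨t, htm, ht⟩ := Finset.exists_subset_card_eq hl
      refine Or.inr ⟨t, htm.trans hms, ht, fun x hx y hy hxy => ?_⟩
      exact (Finset.mem_filter.mp (htm hy)).2 x (hms (htm hx)) hxy
    · have hcard : k * l < (s \ m).card := by
        rw [Finset.card_sdiff_of_subset hms]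
        rw [Nat.succ_mul] at hs
        omega
      rcases ih _ hcard with ⟨t, hts, ht, hrt⟩ | ⟨t, hts, ht⟩
      · have hne : t.Nonempty := Finset.card_pos.mp (by omega)
        have hmin := Finset.mem_sdiff.mp (hts (t.min'_mem hne))
        have hex : ∃ y ∈ s, y < t.min' hne ∧ r y (t.min' hne) := by
          by_contra! hcon
          exact hmin.2 (Finset.mem_filter.mpr ⟨hmin.1, hcon⟩)
        obtain ⟨y, hys, hylt, hry⟩ := hex
        have hlt : ∀ x ∈ t, y < x := fun x hx => hylt.trans_le (t.min'_le x hx)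
        have hrel : ∀ x ∈ t, r y x := fun x hx => by
          rcases (t.min'_le x hx).eq_or_lt with h | h
          · rwa [← h]
          · exact hr _ _ _ hry (hrt _ (t.min'_mem hne) _ hx h)
        refine Or.inl ⟨insert y t, ?_, ?_, ?_⟩
        · exact Finset.insert_subset hys (hts.trans Finset.sdiff_subset)
        · rw [Finset.card_insert_of_notMem (fun h => lt_irrefl _ (hlt y h)), ht]
        · intro x hx z hz hxz
          rcases Finset.mem_insert.mp hx with rfl | hx <;>
            rcases Finset.mem_insert.mp hz with rfl | hz
          · exact absurd hxz (lt_irrefl _)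
          · exact hrel z hz
          · exact absurd hxz (hlt _ ‹_›).not_gt
          · exact hrt x hx z hz hxz
      · exact Or.inr ⟨t, hts.trans Finset.sdiff_subset, ht⟩

/-- Every strict total order on `Fin (b * b + 1)` agrees with, or is opposite to, the natural
order on some subset of size `b`. -/
theorem exists_strictMono_forall_lt_iff (b : ℕ) (lt : Fin (b * b + 1) → Fin (b * b + 1) → Prop)
    (hlt : IsStrictTotalOrder _ lt) :
    ∃ S : Fin b → Fin (b * b + 1), StrictMono S ∧
      ((∀ i j, lt (S i) (S j) ↔ i < j) ∨ (∀ i j, lt (S i) (S j) ↔ j < i)) := by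
  have hirr : ∀ x, ¬ lt x x := hlt.toIrrefl.irrefl
  have htr : ∀ x y z, lt x y → lt y z → lt x z := hlt.toIsTrans.trans
  have htri : ∀ x y, ¬ lt x y → ¬ lt y x → x = y := hlt.toTrichotomous.trichotomous
  rcases exists_subset_rel_or_not_rel lt htr b b Finset.univ (by simp) with
    ⟨t, -, ht, h⟩ | ⟨t, -, ht, h⟩
  all_goals
    set S : Fin b → Fin (b * b + 1) := t.orderEmbOfFin ht ∘ Fin.castSucc
    have hS : StrictMono S := (t.orderEmbOfFin ht).strictMono.comp Fin.strictMono_castSucc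
    have hmem : ∀ i, S i ∈ t := fun i => t.orderEmbOfFin_mem ht _
    refine ⟨S, hS, ?_⟩
  · refine Or.inl fun i j => ⟨fun hij => ?_, fun hij => h _ (hmem i) _ (hmem j) (hS hij)⟩
    by_contra hji
    rcases (not_lt.mp hji).eq_or_lt with rfl | hji
    · exact hirr _ hij
    · exact hirr _ (htr _ _ _ hij (h _ (hmem j) _ (hmem i) (hS hji)))
  · refine Or.inr fun i j => ⟨fun hij => ?_, fun hij => ?_⟩
    · by_contra hji
      rcases (not_lt.mp hji).eq_or_lt with rfl | hji
      · exact hirr _ hij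
      · exact h _ (hmem i) _ (hmem j) (hS hji) hij
    · by_contra hcon
      exact (hS hij).ne (htri _ _ (h _ (hmem j) _ (hmem i) (hS hij)) hcon)

/-- A monotonically coloured finite linear order whose color class `i` contains `Fin N`, and which
contains, for every `S : Fin b → Fin N`, a color-preserving image of `Fin b`; these images are
given by `S` on the color class `i` and are pairwise disjoint outside of it. -/
theorem exists_amalgam {n b : ℕ} (lam : Fin b → Fin n) (hlam : Monotone lam) (i : Fin n) (N : ℕ) :
    ∃ (c : ℕ) (lamZ : Fin c → Fin n) (h : Fin N → Fin c)
      (g : (Fin b → Fin N) → Fin b → Fin c),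
      Monotone lamZ ∧ StrictMono h ∧ (∀ S v, lamZ (g S v) = lam v) ∧
      (∀ S, StrictMono S → StrictMono (g S)) ∧
      (∀ S v, lam v = i → g S v = h (S v)) ∧
      (∀ S S' v v', lam v ≠ i → g S v = g S' v' → S = S' ∧ v = v') := by
  classical
  obtain ⟨c, ⟨φ⟩⟩ : ∃ c, Nonempty
      (Fin n ×ₗ (Fin N ⊕ₗ (Lex (Fin b → Fin N) ×ₗ Fin b)) ≃o Fin c) := by
    have : Fintype (Fin n ×ₗ (Fin N ⊕ₗ (Lex (Fin b → Fin N) ×ₗ Fin b))) :=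
      inferInstanceAs (Fintype (Fin n × (Fin N ⊕ ((Fin b → Fin N) × Fin b))))
    exact ⟨_, ⟨(Fintype.orderIsoFinOfCardEq _ rfl).symm⟩⟩
  let h₀ : Fin N → Fin n ×ₗ (Fin N ⊕ₗ (Lex (Fin b → Fin N) ×ₗ Fin b)) :=
    fun x => toLex (i, toLex (Sum.inl x))
  let g₀ : (Fin b → Fin N) → Fin b → Fin n ×ₗ (Fin N ⊕ₗ (Lex (Fin b → Fin N) ×ₗ Fin b)) :=
    fun S v => toLex (lam v, if lam v = i then toLex (Sum.inl (S v))
      else toLex (Sum.inr (toLex (toLex S, v))))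
  refine ⟨c, fun p => (ofLex (φ.symm p)).1, fun x => φ (h₀ x),
    fun S v => φ (g₀ S v), ?_, ?_, ?_, ?_, ?_, ?_⟩
  · exact Prod.Lex.monotone_fst_ofLex.comp φ.symm.monotone
  · refine φ.strictMono.comp fun x y hxy => ?_
    exact Prod.Lex.toLex_lt_toLex.mpr (Or.inr ⟨rfl, Sum.Lex.inl_lt_inl_iff.mpr hxy⟩)
  · intro S v
    simp [g₀]
  · refine fun S hS => φ.strictMono.comp fun u v huv => ?_
    refine Prod.Lex.toLex_lt_toLex.mpr ?_
    rcases (hlam huv.le).lt_or_eq with hlt | heq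
    · exact Or.inl hlt
    · refine Or.inr ⟨heq, ?_⟩
      by_cases hv : lam v = i
      · simpa [heq, hv] using hS huv
      · simpa [heq, hv, Prod.Lex.toLex_lt_toLex] using huv
  · intro S v hv
    simp [g₀, h₀, hv]
  · intro S S' v v' hv heq
    have heq' := toLex.injective (φ.injective heq)
    rw [Prod.mk.injEq] at heq'
    rw [if_neg hv, if_neg (heq'.1 ▸ hv)] at heq'
    simpa using heq'.2

/-- Every `(Y, lam)` in `M^<_n` embeds in some `(Z, lamZ)` in `M^<_n` so that every linear order
on `Z` is monotone on the color class `i` of some copy of `Y`. -/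
theorem exists_monotone_on_color {n b : ℕ} (Y : SimpleGraph (Fin b)) (lam : Fin b → Fin n)
    (hY : ProperCol Y lam) (hlam : Monotone lam) (i : Fin n) :
    ∃ (c : ℕ) (Z : SimpleGraph (Fin c)) (lamZ : Fin c → Fin n),
      ProperCol Z lamZ ∧ Monotone lamZ ∧
      ∀ lt : Fin c → Fin c → Prop, IsStrictTotalOrder (Fin c) lt →
        ∃ e : Fin b → Fin c, ColOrdEmb Y lam Z lamZ e ∧
          ((∀ u v, lam u = i → lam v = i → (lt (e u) (e v) ↔ u < v)) ∨
            (∀ u v, lam u = i → lam v = i → (lt (e u) (e v) ↔ v < u))) := by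
  obtain ⟨c, lamZ, h, g, hmono, hh, hcol, hgmono, hgi, hginj⟩ :=
    exists_amalgam lam hlam i (b * b + 1)
  let Z : SimpleGraph (Fin c) :=
    { Adj := fun p q => ∃ S, ∃ u v, Y.Adj u v ∧ p = g S u ∧ q = g S v
      symm := ⟨by
        rintro p q ⟨S, u, v, huv, hp, hq⟩
        exact ⟨S, v, u, huv.symm, hq, hp⟩⟩
      loopless := ⟨by
        rintro p ⟨S, u, v, huv, hp, hq⟩
        exact hY u v huv (by rw [← hcol S u, ← hcol S v, ← hp, ← hq])⟩ }
  refine ⟨c, Z, lamZ, ?_, hmono, fun lt hlt => ?_⟩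
  · rintro p q ⟨S, u, v, huv, rfl, rfl⟩
    rw [hcol, hcol]
    exact hY u v huv
  · obtain ⟨S, hS, hmon⟩ := exists_strictMono_forall_lt_iff b (fun x y => lt (h x) (h y))
      (RelEmbedding.isStrictTotalOrder
        (⟨⟨h, hh.injective⟩, Iff.rfl⟩ : (fun x y => lt (h x) (h y)) ↪r lt))
    refine ⟨g S, ⟨⟨hgmono S hS, fun u v => ⟨?_, fun huv => ⟨S, u, v, huv, rfl, rfl⟩⟩⟩,
      hcol S⟩, ?_⟩
    · rintro ⟨S', u', v', huv, hu, hv⟩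
      have hu' : lam u = lam u' := by rw [← hcol S u, hu, hcol]
      have hv' : lam v = lam v' := by rw [← hcol S v, hv, hcol]
      have hinj := (hgmono S hS).injective
      by_cases hui : lam u = i
      · have hvi : lam v ≠ i := fun hvi => hY u' v' huv (by rw [← hu', ← hv', hui, hvi])
        obtain ⟨rfl, rfl⟩ := hginj _ _ _ _ hvi hv
        rwa [hinj hu]
      · obtain ⟨rfl, rfl⟩ := hginj _ _ _ _ hui hu
        rwa [hinj hv]
    · refine hmon.imp (fun hm u v hu hv => ?_) (fun hm u v hu hv => ?_)
      all_goals
        rw [hgi S u hu, hgi S v hv]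
        exact hm u v

theorem ColOrdEmb.comp {n a b c : ℕ} {X : SimpleGraph (Fin a)} {lamX : Fin a → Fin n}
    {Y : SimpleGraph (Fin b)} {lamY : Fin b → Fin n} {Z : SimpleGraph (Fin c)}
    {lamZ : Fin c → Fin n} {f : Fin b → Fin c} {e : Fin a → Fin b}
    (hf : ColOrdEmb Y lamY Z lamZ f) (he : ColOrdEmb X lamX Y lamY e) :
    ColOrdEmb X lamX Z lamZ (f ∘ e) :=
  ⟨⟨hf.1.1.comp he.1.1, fun i j => (hf.1.2 _ _).trans (he.1.2 i j)⟩,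
    fun i => (hf.2 _).trans (he.2 i)⟩

/-- Every `(Y, lam)` in `M^<_n` embeds in some `(Z, lamZ)` in `M^<_n` so that every linear order
on `Z` is monotone on each of the color classes in `s` of some copy of `Y`. -/
theorem exists_monotone_on_colors {n b : ℕ} (Y : SimpleGraph (Fin b)) (lam : Fin b → Fin n)
    (hY : ProperCol Y lam) (hlam : Monotone lam) (s : Finset (Fin n)) :
    ∃ (c : ℕ) (Z : SimpleGraph (Fin c)) (lamZ : Fin c → Fin n),
      ProperCol Z lamZ ∧ Monotone lamZ ∧
      ∀ lt : Fin c → Fin c → Prop, IsStrictTotalOrder (Fin c) lt →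
        ∃ e : Fin b → Fin c, ColOrdEmb Y lam Z lamZ e ∧
          ∀ col ∈ s,
            (∀ u v, lam u = col → lam v = col → (lt (e u) (e v) ↔ u < v)) ∨
            (∀ u v, lam u = col → lam v = col → (lt (e u) (e v) ↔ v < u)) := by
  classical
  induction s using Finset.induction_on with
  | empty =>
    exact ⟨b, Y, lam, hY, hlam, fun _ _ =>
      ⟨id, ⟨⟨strictMono_id, fun _ _ => Iff.rfl⟩, fun _ => rfl⟩, by simp⟩⟩
  | insert i s _ ih =>
    obtain ⟨c, Z, lamZ, hZ, hZm, ihZ⟩ := ih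
    obtain ⟨d, W, lamW, hW, hWm, hWZ⟩ := exists_monotone_on_color Z lamZ hZ hZm i
    refine ⟨d, W, lamW, hW, hWm, fun lt hlt => ?_⟩
    obtain ⟨f, hf, hfi⟩ := hWZ lt hlt
    obtain ⟨e, he, hes⟩ := ihZ (fun x y => lt (f x) (f y))
      (RelEmbedding.isStrictTotalOrder
        (⟨⟨f, hf.1.1.injective⟩, Iff.rfl⟩ : (fun x y => lt (f x) (f y)) ↪r lt))
    refine ⟨f ∘ e, hf.comp he, fun col hcol => ?_⟩
    rcases Finset.mem_insert.mp hcol with rfl | hcol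
    · refine hfi.imp (fun hm u v hu hv => ?_) (fun hm u v hu hv => ?_)
      all_goals
        exact (hm _ _ ((he.2 u).trans hu) ((he.2 v).trans hv)).trans he.1.1.lt_iff_lt
    · exact hes col hcol

/-- for every `(Y, lamY) ∈ M^<_n` there is `(Z, lamZ) ∈ M^<_n` such
that for every linear order `lt` on the vertices of `Z` for which all
`lamZ`-color classes are `lt`-convex, there is a copy of `Y` in `Z` on each of
whose color classes `lt` coincides with, or is opposite to, the order of the copy. -/
theorem stmt_16 (n : ℕ) (hn : 1 ≤ n) (b : ℕ)
    (Y : SimpleGraph (Fin b)) (lamY : Fin b → Fin n)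
    (hY : ProperCol Y lamY) (hYm : Monotone lamY) :
    ∃ (c : ℕ) (Z : SimpleGraph (Fin c)) (lamZ : Fin c → Fin n),
      ProperCol Z lamZ ∧ Monotone lamZ ∧
      ∀ lt : Fin c → Fin c → Prop, IsStrictTotalOrder (Fin c) lt →
        (∀ x y z : Fin c, lt x y → lt y z → lamZ x = lamZ z → lamZ y = lamZ x) →
        ∃ e : Fin b → Fin c, ColOrdEmb Y lamY Z lamZ e ∧
          ∀ col : Fin n,
            (∀ i j, lamY i = col → lamY j = col → (lt (e i) (e j) ↔ i < j)) ∨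
            (∀ i j, lamY i = col → lamY j = col → (lt (e i) (e j) ↔ j < i)) := by
  obtain ⟨c, Z, lamZ, hZ, hZm, h⟩ := exists_monotone_on_colors Y lamY hY hYm Finset.univ
  refine ⟨c, Z, lamZ, hZ, hZm, fun lt hlt _ => ?_⟩
  obtain ⟨e, he, hcol⟩ := h lt hlt
  exact ⟨e, he, fun col => hcol col (Finset.mem_univ col)⟩
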